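/- Let φ(x) = (2π)^(−1/2) exp(−x²/2) denote the standard normal density and Φ(x) = ∫_{−∞}^x φ(t) dt the standard normal CDF. Fix σ > 0, λ > 0, a finite index set Ω, vectors u_i ∈ ℝ^d and thresholds a_i < b_i for i ∈ Ω. Then the regularized Probit sketching objective G(ψ) = Σ_{i∈Ω} −log( Φ((b_i − ⟨u_i, ψ⟩)/σ) − Φ((a_i − ⟨u_i, ψ⟩)/σ) ) + (λ/2)‖ψ‖² is λ-strongly convex on ℝ^d, i.e., ψ ↦ G(ψ) − (λ/2)‖ψ‖² is convex. -/

import Mathlib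

open MeasureTheory RealInnerProductSpace

/-- The standard normal density `φ(x) = (2π)^(−1/2) exp(−x²/2)`. -/
noncomputable def stdNormalPDF (x : ℝ) : ℝ :=
  (Real.sqrt (2 * Real.pi))⁻¹ * Real.exp (-x ^ 2 / 2)

/-- The standard normal CDF `Φ(x) = ∫_{−∞}^x φ(t) dt`. -/
noncomputable def stdNormalCDF (x : ℝ) : ℝ :=
  ∫ t in Set.Iic x, stdNormalPDF t

/-- Convexity of `-log h` from second-order data along with positivity of `h`. -/
theorem convexOn_neg_log_of_hasDerivAt {h h' h'' : ℝ → ℝ} (hpos : ∀ s, 0 < h s)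
    (hd : ∀ s, HasDerivAt h (h' s) s) (hd' : ∀ s, HasDerivAt h' (h'' s) s)
    (hle : ∀ s, h s * h'' s ≤ h' s ^ 2) :
    ConvexOn ℝ Set.univ (fun s => -Real.log (h s)) := by
  have h1 : ∀ s, HasDerivAt (fun s => -Real.log (h s)) (-(h' s / h s)) s := fun s =>
    ((hd s).log (hpos s).ne').neg
  have h2 : ∀ s, HasDerivAt (fun s => -(h' s / h s))
      (-((h'' s * h s - h' s * h' s) / h s ^ 2)) s := fun s =>
    ((hd' s).div (hd s) (hpos s).ne').neg
  have e1 : deriv (fun s => -Real.log (h s)) = fun s => -(h' s / h s) :=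
    funext fun s => (h1 s).deriv
  refine convexOn_univ_of_deriv2_nonneg (fun s => (h1 s).differentiableAt)
    (e1 ▸ fun s => (h2 s).differentiableAt) fun s => ?_
  rw [Function.iterate_succ_apply, Function.iterate_one, e1, (h2 s).deriv, ← neg_div]
  refine div_nonneg ?_ (sq_nonneg _)
  linarith [hle s]

theorem stdNormalPDF_pos (x : ℝ) : 0 < stdNormalPDF x := by
  unfold stdNormalPDF
  positivity

theorem hasDerivAt_stdNormalPDF (x : ℝ) :
    HasDerivAt stdNormalPDF (-x * stdNormalPDF x) x := by
  have h : HasDerivAt (fun y : ℝ => -y ^ 2 / 2) (-x) x := by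
    refine ((hasDerivAt_pow 2 x).neg.div_const 2).congr_deriv ?_
    norm_num
    ring
  refine (h.exp.const_mul (Real.sqrt (2 * Real.pi))⁻¹).congr_deriv ?_
  unfold stdNormalPDF
  ring

theorem continuous_stdNormalPDF : Continuous stdNormalPDF :=
  continuous_iff_continuousAt.2 fun x => (hasDerivAt_stdNormalPDF x).continuousAt

theorem integrable_stdNormalPDF : Integrable stdNormalPDF := by
  unfold stdNormalPDF
  refine Integrable.const_mul ?_ _
  convert integrable_exp_neg_mul_sq (b := 1 / 2) (by norm_num) using 3
  ring

theorem hasDerivAt_stdNormalCDF (x : ℝ) :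
    HasDerivAt stdNormalCDF (stdNormalPDF x) x := by
  have h : stdNormalCDF = fun y => stdNormalCDF 0 + ∫ t in (0 : ℝ)..y, stdNormalPDF t := by
    funext y
    rw [← intervalIntegral.integral_Iic_sub_Iic integrable_stdNormalPDF.integrableOn
      integrable_stdNormalPDF.integrableOn]
    simp [stdNormalCDF]
  rw [h]
  exact (continuous_stdNormalPDF.integral_hasStrictDerivAt 0 x).hasDerivAt.const_add _

theorem strictMono_stdNormalCDF : StrictMono stdNormalCDF :=
  strictMono_of_deriv_pos fun x => by
    rw [(hasDerivAt_stdNormalCDF x).deriv]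
    exact stdNormalPDF_pos x

/-- The standard normal mass of an interval satisfies the second-order log-concavity inequality
under translation of the interval. -/
theorem stdNormalCDF_sub_mul_le_sq {x y : ℝ} (hxy : x < y) :
    (stdNormalCDF y - stdNormalCDF x) * (-y * stdNormalPDF y - -x * stdNormalPDF x)
      ≤ (stdNormalPDF y - stdNormalPDF x) ^ 2 := by
  obtain ⟨c, ⟨hxc, hcy⟩, hc⟩ := exists_ratio_hasDerivAt_eq_ratio_slope stdNormalPDF
    (fun z => -z * stdNormalPDF z) hxy continuous_stdNormalPDF.continuousOn
    (fun z _ => hasDerivAt_stdNormalPDF z) stdNormalCDF stdNormalPDF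
    (fun z _ => (hasDerivAt_stdNormalCDF z).continuousAt.continuousWithinAt)
    (fun z _ => hasDerivAt_stdNormalCDF z)
  have hm : stdNormalPDF y - stdNormalPDF x = -c * (stdNormalCDF y - stdNormalCDF x) := by
    refine mul_right_cancel₀ (stdNormalPDF_pos c).ne' ?_
    linarith
  have hH : 0 < stdNormalCDF y - stdNormalCDF x := sub_pos.2 (strictMono_stdNormalCDF hxy)
  have key : 0 ≤ (stdNormalCDF y - stdNormalCDF x) *
      ((y - c) * stdNormalPDF y + (c - x) * stdNormalPDF x) :=
    mul_nonneg hH.le (add_nonneg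
      (mul_nonneg (sub_nonneg.2 hcy.le) (stdNormalPDF_pos y).le)
      (mul_nonneg (sub_nonneg.2 hxc.le) (stdNormalPDF_pos x).le))
  linear_combination key - (stdNormalPDF y - stdNormalPDF x) * hm

theorem convexOn_neg_log_stdNormalCDF_sub {w : ℝ} (hw : 0 < w) :
    ConvexOn ℝ Set.univ (fun s => -Real.log (stdNormalCDF (s + w) - stdNormalCDF s)) :=
  convexOn_neg_log_of_hasDerivAt
    (fun s => sub_pos.2 (strictMono_stdNormalCDF (lt_add_of_pos_right s hw)))
    (fun s => ((hasDerivAt_stdNormalCDF (s + w)).comp_add_const s w).sub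
      (hasDerivAt_stdNormalCDF s))
    (fun s => ((hasDerivAt_stdNormalPDF (s + w)).comp_add_const s w).sub
      (hasDerivAt_stdNormalPDF s))
    (fun s => stdNormalCDF_sub_mul_le_sq (lt_add_of_pos_right s hw))

/-- Each negative log-likelihood term of the Probit model is convex in the parameter. -/
theorem convexOn_probit_neg_log_likelihood {E : Type*} [NormedAddCommGroup E]
    [InnerProductSpace ℝ E] {σ a b : ℝ} (hσ : 0 < σ) (hab : a < b) (u : E) :
    ConvexOn ℝ Set.univ (fun ψ : E =>
      -Real.log (stdNormalCDF ((b - ⟪u, ψ⟫) / σ) - stdNormalCDF ((a - ⟪u, ψ⟫) / σ))) := by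
  have h := (convexOn_neg_log_stdNormalCDF_sub (div_pos (sub_pos.2 hab) hσ)).comp_affineMap
    (AffineMap.const ℝ E (a / σ) - (σ⁻¹ • (innerSL ℝ u).toLinearMap).toAffineMap)
  refine h.congr fun ψ _ => ?_
  have ha : (a - ⟪u, ψ⟫) / σ = a / σ - σ⁻¹ * ⟪u, ψ⟫ := by ring
  have hb : (b - ⟪u, ψ⟫) / σ = a / σ - σ⁻¹ * ⟪u, ψ⟫ + (b - a) / σ := by ring
  rw [ha, hb]
  simp

/-- The regularized Probit sketching objective
`G(ψ) = Σ_{i∈Ω} −log(Φ((b_i − ⟨u_i, ψ⟩)/σ) − Φ((a_i − ⟨u_i, ψ⟩)/σ)) + (λ/2)‖ψ‖²`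
is `λ`-strongly convex on `ℝ^d`: `G − (λ/2)‖·‖²` is convex. -/
theorem probit_objective_strongly_convex {d : ℕ} {ι : Type*} (σ lam : ℝ) (hσ : 0 < σ)
    (hlam : 0 < lam) (Ω : Finset ι) (u : ι → EuclideanSpace ℝ (Fin d)) (a b : ι → ℝ)
    (hab : ∀ i ∈ Ω, a i < b i) :
    ConvexOn ℝ Set.univ
      (fun ψ : EuclideanSpace ℝ (Fin d) =>
        (∑ i ∈ Ω,
            -Real.log (stdNormalCDF ((b i - ⟪u i, ψ⟫) / σ)
              - stdNormalCDF ((a i - ⟪u i, ψ⟫) / σ)) + (lam / 2) * ‖ψ‖ ^ 2)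
          - (lam / 2) * ‖ψ‖ ^ 2) := by
  simp only [add_sub_cancel_right]
  have h : ∀ i ∈ Ω, ConvexOn ℝ Set.univ (fun ψ : EuclideanSpace ℝ (Fin d) =>
      -Real.log (stdNormalCDF ((b i - ⟪u i, ψ⟫) / σ) - stdNormalCDF ((a i - ⟪u i, ψ⟫) / σ))) :=
    fun i hi => convexOn_probit_neg_log_likelihood hσ (hab i hi) (u i)
  clear hab
  induction Ω using Finset.cons_induction with
  | empty => simpa using convexOn_const (0 : ℝ) convex_univ
  | cons i t hi ih =>
    simp only [Finset.sum_cons]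
    exact (h i (Finset.mem_cons_self i t)).add
      (ih fun j hj => h j (Finset.mem_cons_of_mem hj))
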